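/- (James–Stein best equivariant estimator) For every T ∈ T⁺, the generalized Bayes estimator under Stein loss with respect to the prior γ(dΘ) equals the James–Stein estimator: ( ∫_{T⁺} Θᵀ Θ f_W(T | Θ) γ(dΘ) )^{−1} · ( ∫_{T⁺} f_W(T | Θ) γ(dΘ) ) = T D Tᵀ, where D = diag(d₁, …, d_p) with d_i = 1/(n+p−2i+1); here the first factor is the inverse of the matrix-valued integral and the second factor is a scalar. -/

import Mathlib

open MeasureTheory ENNReal Matrix

abbrev LowIdx (p : ℕ) := {q : Fin p × Fin p // q.2 ≤ q.1}
abbrev TriCoords (p : ℕ) := LowIdx p → ℝ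

noncomputable def triMat {p : ℕ} (x : TriCoords p) : Matrix (Fin p) (Fin p) ℝ :=
  Matrix.of fun i j => if h : j ≤ i then x ⟨(i, j), h⟩ else 0

def triPos (p : ℕ) : Set (TriCoords p) :=
  {x | ∀ i : Fin p, 0 < x ⟨(i, i), le_rfl⟩}

noncomputable def gammaDens {p : ℕ} (x : TriCoords p) : ℝ≥0∞ :=
  ∏ i : Fin p, ENNReal.ofReal (x ⟨(i, i), le_rfl⟩ ^ (-((i : ℕ) + 1) : ℤ))

noncomputable def gammaDensR {p : ℕ} (x : TriCoords p) : ℝ :=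
  ∏ i : Fin p, x ⟨(i, i), le_rfl⟩ ^ (-((i : ℕ) + 1) : ℤ)

instance matrixMeasurableSpace {p : ℕ} : MeasurableSpace (Matrix (Fin p) (Fin p) ℝ) :=
  inferInstanceAs (MeasurableSpace (Fin p → Fin p → ℝ))

def memTplus {p : ℕ} (A : Matrix (Fin p) (Fin p) ℝ) : Prop :=
  (∀ i j : Fin p, i < j → A i j = 0) ∧ ∀ i : Fin p, 0 < A i i

noncomputable def wishartC (p n : ℕ) : ℝ :=
  2 ^ ((p : ℝ) * ((n : ℝ) - 2) / 2) * Real.pi ^ ((p : ℝ) * ((p : ℝ) - 1) / 4) *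
    ∏ i : Fin p, Real.Gamma (((n : ℝ) - (i : ℕ)) / 2)

noncomputable def wishartDens (p n : ℕ) (Θ T : Matrix (Fin p) (Fin p) ℝ) : ℝ :=
  (Θ * T).det ^ n * Real.exp (-(1 / 2) * ((Θ * T) * (Θ * T)ᵀ).trace) / wishartC p n

lemma integrable_pow_mul_exp_neg_half_sq (m : ℕ) :
    Integrable fun t : ℝ => t ^ m * Real.exp (-(1 / 2) * t ^ 2) := by
  have h := integrable_rpow_mul_exp_neg_mul_sq (b := 1 / 2) (by norm_num) (s := m)
    (by have : (0 : ℝ) ≤ m := m.cast_nonneg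
        linarith)
  simpa only [Real.rpow_natCast] using h

lemma integral_Ioi_pow_mul_exp_neg_half_sq (m : ℕ) :
    ∫ t in Set.Ioi (0 : ℝ), t ^ m * Real.exp (-(1 / 2) * t ^ 2) =
      (1 / 2) ^ (-((m : ℝ) + 1) / 2) * (1 / 2) * Real.Gamma (((m : ℝ) + 1) / 2) := by
  have h := integral_rpow_mul_exp_neg_mul_rpow (p := 2) (q := m) (b := 1 / 2) (by norm_num)
    (by have : (0 : ℝ) ≤ m := m.cast_nonneg
        linarith) (by norm_num)
  rw [← h]
  congr! 4 with t
  · rw [Real.rpow_natCast]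
  · norm_num

lemma integral_Ioi_pow_mul_exp_neg_half_sq_pos (m : ℕ) :
    0 < ∫ t in Set.Ioi (0 : ℝ), t ^ m * Real.exp (-(1 / 2) * t ^ 2) := by
  rw [integral_Ioi_pow_mul_exp_neg_half_sq]
  have := Real.Gamma_pos_of_pos (s := ((m : ℝ) + 1) / 2) (by positivity)
  positivity

lemma integral_Ioi_pow_add_two_mul_exp_neg_half_sq (m : ℕ) :
    ∫ t in Set.Ioi (0 : ℝ), t ^ (m + 2) * Real.exp (-(1 / 2) * t ^ 2) =
      ((m : ℝ) + 1) * ∫ t in Set.Ioi (0 : ℝ), t ^ m * Real.exp (-(1 / 2) * t ^ 2) := by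
  rw [integral_Ioi_pow_mul_exp_neg_half_sq, integral_Ioi_pow_mul_exp_neg_half_sq]
  have e1 : (((m + 2 : ℕ) : ℝ) + 1) / 2 = ((m : ℝ) + 1) / 2 + 1 := by push_cast; ring
  have e2 : -(((m + 2 : ℕ) : ℝ) + 1) / 2 = -((m : ℝ) + 1) / 2 - 1 := by push_cast; ring
  rw [e1, e2, Real.Gamma_add_one (by positivity), Real.rpow_sub_one (by norm_num)]
  ring

lemma integral_pow_mul_exp_neg_half_sq_of_even {m : ℕ} (hm : Even m) :
    ∫ t : ℝ, t ^ m * Real.exp (-(1 / 2) * t ^ 2) =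
      2 * ∫ t in Set.Ioi (0 : ℝ), t ^ m * Real.exp (-(1 / 2) * t ^ 2) := by
  rw [← integral_comp_abs]
  simp only [hm.pow_abs, sq_abs]

lemma integral_mul_exp_neg_half_sq :
    ∫ t : ℝ, t * Real.exp (-(1 / 2) * t ^ 2) = 0 := by
  have h := integral_neg_eq_self (fun t : ℝ => t * Real.exp (-(1 / 2) * t ^ 2)) volume
  simp only [neg_mul, neg_sq, integral_neg] at h ⊢
  linarith

/-- The exponent of a coordinate in the density of the Cholesky factor of a Wishart matrix
with respect to Lebesgue measure. -/
def coordExp {p : ℕ} (n : ℕ) (q : LowIdx p) : ℕ :=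
  if q.1.1 = q.1.2 then n - (q.1.1 + 1) else 0

/-- The range of a coordinate over `triPos p`. -/
def coordRange {p : ℕ} (q : LowIdx p) : Set ℝ :=
  if q.1.1 = q.1.2 then Set.Ioi 0 else Set.univ

/-- The unnormalized Lebesgue density of the Cholesky factor of a standard Wishart matrix. -/
noncomputable def choleskyWeight {p : ℕ} (n : ℕ) (x : TriCoords p) : ℝ :=
  ∏ q : LowIdx p, x q ^ coordExp n q * Real.exp (-(1 / 2) * x q ^ 2)

/-- The `r`-th unnormalized moment of a coordinate under `choleskyWeight`. -/
noncomputable def coordMoment {p : ℕ} (n : ℕ) (q : LowIdx p) (r : ℕ) : ℝ :=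
  ∫ t in coordRange q, t ^ (r + coordExp n q) * Real.exp (-(1 / 2) * t ^ 2)

lemma coordMoment_zero_pos {p : ℕ} (n : ℕ) (q : LowIdx p) : 0 < coordMoment n q 0 := by
  unfold coordMoment coordRange coordExp
  split_ifs with h
  · exact integral_Ioi_pow_mul_exp_neg_half_sq_pos _
  · rw [setIntegral_univ, integral_pow_mul_exp_neg_half_sq_of_even (by simp)]
    exact mul_pos two_pos (integral_Ioi_pow_mul_exp_neg_half_sq_pos _)

lemma coordMoment_one {p : ℕ} (n : ℕ) (q : LowIdx p) (h : q.1.1 ≠ q.1.2) :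
    coordMoment n q 1 = 0 := by
  simpa [coordMoment, coordRange, coordExp, h] using integral_mul_exp_neg_half_sq

lemma coordMoment_two {p n : ℕ} (hn : p ≤ n) (q : LowIdx p) :
    coordMoment n q 2 =
      (if q.1.1 = q.1.2 then (n : ℝ) - (q.1.1 : ℕ) else 1) * coordMoment n q 0 := by
  unfold coordMoment coordRange coordExp
  split_ifs with h
  · rw [add_comm 2, integral_Ioi_pow_add_two_mul_exp_neg_half_sq,
      Nat.cast_sub (by have := q.1.1.2; omega), zero_add]
    push_cast
    ring
  · rw [setIntegral_univ, setIntegral_univ, integral_pow_mul_exp_neg_half_sq_of_even (by simp),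
      integral_pow_mul_exp_neg_half_sq_of_even (by simp), add_zero]
    have h := integral_Ioi_pow_add_two_mul_exp_neg_half_sq 0
    simp only [zero_add, Nat.cast_zero, one_mul] at h
    rw [h, one_mul]

lemma triPos_eq_pi (p : ℕ) : triPos p = Set.univ.pi fun q : LowIdx p => coordRange q := by
  ext x
  simp only [triPos, coordRange, Set.mem_ofPred_eq, Set.mem_pi, Set.mem_univ, true_imp_iff]
  constructor
  · rintro h ⟨⟨i, j⟩, hij⟩
    by_cases e : i = j
    · subst e; simpa using h i
    · simp [e]
  · intro h i
    simpa using h ⟨(i, i), le_rfl⟩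

lemma volume_restrict_triPos (p : ℕ) :
    (volume : Measure (TriCoords p)).restrict (triPos p) =
      Measure.pi fun q : LowIdx p => volume.restrict (coordRange q) := by
  rw [triPos_eq_pi, volume_pi, Measure.restrict_pi_pi]

lemma measurableSet_triPos (p : ℕ) : MeasurableSet (triPos p) := by
  rw [triPos_eq_pi]
  refine MeasurableSet.univ_pi fun q => ?_
  unfold coordRange
  split_ifs
  exacts [measurableSet_Ioi, MeasurableSet.univ]

lemma prod_pow_mul_choleskyWeight {p : ℕ} (n : ℕ) (r : LowIdx p → ℕ) (x : TriCoords p) :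
    (∏ q, x q ^ r q) * choleskyWeight n x =
      ∏ q, x q ^ (r q + coordExp n q) * Real.exp (-(1 / 2) * x q ^ 2) := by
  rw [choleskyWeight, ← Finset.prod_mul_distrib]
  exact Finset.prod_congr rfl fun q _ => by rw [pow_add]; ring

lemma integrableOn_prod_pow_mul_choleskyWeight {p : ℕ} (n : ℕ) (r : LowIdx p → ℕ) :
    IntegrableOn (fun x : TriCoords p => (∏ q, x q ^ r q) * choleskyWeight n x) (triPos p) := by
  simp only [prod_pow_mul_choleskyWeight, IntegrableOn, volume_restrict_triPos]
  exact Integrable.fintype_prod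
    (f := fun q t => t ^ (r q + coordExp n q) * Real.exp (-(1 / 2) * t ^ 2))
    fun q => (integrable_pow_mul_exp_neg_half_sq _).integrableOn

lemma setIntegral_prod_pow_mul_choleskyWeight {p : ℕ} (n : ℕ) (r : LowIdx p → ℕ) :
    ∫ x in triPos p, (∏ q, x q ^ r q) * choleskyWeight n x = ∏ q, coordMoment n q (r q) := by
  simp only [prod_pow_mul_choleskyWeight, volume_restrict_triPos]
  exact integral_fintype_prod_eq_prod
    (fun q t => t ^ (r q + coordExp n q) * Real.exp (-(1 / 2) * t ^ 2))

lemma setIntegral_choleskyWeight {p : ℕ} (n : ℕ) :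
    ∫ x in triPos p, choleskyWeight n x = ∏ q : LowIdx p, coordMoment n q 0 := by
  simpa using setIntegral_prod_pow_mul_choleskyWeight n (fun _ : LowIdx p => 0)

lemma setIntegral_choleskyWeight_pos (p n : ℕ) :
    0 < ∫ x in triPos p, choleskyWeight n x := by
  rw [setIntegral_choleskyWeight]
  exact Finset.prod_pos fun q _ => coordMoment_zero_pos n q

lemma mul_eq_prod_pow {ι : Type*} [Fintype ι] [DecidableEq ι] (x : ι → ℝ) (a b : ι) :
    x a * x b = ∏ q, x q ^ ((if a = q then 1 else 0) + if b = q then 1 else 0) := by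
  simp only [pow_add, Finset.prod_mul_distrib, Finset.prod_pow_boole, Finset.mem_univ, if_true]

lemma integrableOn_mul_mul_choleskyWeight {p : ℕ} (n : ℕ) (a b : LowIdx p) :
    IntegrableOn (fun x : TriCoords p => x a * x b * choleskyWeight n x) (triPos p) := by
  simp only [mul_eq_prod_pow]
  exact integrableOn_prod_pow_mul_choleskyWeight n _

lemma setIntegral_mul_mul_choleskyWeight {p n : ℕ} (hn : p ≤ n) (a b : LowIdx p)
    (hab : a.1.1 = b.1.1) :
    ∫ x in triPos p, x a * x b * choleskyWeight n x =
      (if a = b then if a.1.1 = a.1.2 then (n : ℝ) - (a.1.1 : ℕ) else 1 else 0) *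
        ∫ x in triPos p, choleskyWeight n x := by
  simp only [mul_eq_prod_pow]
  rw [setIntegral_prod_pow_mul_choleskyWeight, setIntegral_choleskyWeight]
  by_cases h : a = b
  · subst h
    rw [← Finset.mul_prod_erase _ _ (Finset.mem_univ a),
      ← Finset.mul_prod_erase _ (fun q => coordMoment n q 0) (Finset.mem_univ a), ← mul_assoc]
    congr 1
    · simp [coordMoment_two hn]
    · refine Finset.prod_congr rfl fun q hq => ?_
      simp [(Finset.ne_of_mem_erase hq).symm]
  · rw [if_neg h, zero_mul]
    by_cases ha : a.1.1 = a.1.2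
    · refine Finset.prod_eq_zero (Finset.mem_univ b) ?_
      have hb : b.1.1 ≠ b.1.2 := fun hb =>
        h (Subtype.ext (Prod.ext hab (by rw [← ha, ← hb, hab])))
      simpa [h] using coordMoment_one n b hb
    · refine Finset.prod_eq_zero (Finset.mem_univ a) ?_
      simpa [Ne.symm h] using coordMoment_one n a ha

lemma triMat_apply {p : ℕ} (x : TriCoords p) (i j : Fin p) :
    triMat x i j = if h : j ≤ i then x ⟨(i, j), h⟩ else 0 := rfl

lemma integrableOn_triMat_mul_triMat_mul_choleskyWeight {p : ℕ} (n : ℕ) (i j k : Fin p) :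
    IntegrableOn (fun x : TriCoords p => triMat x i j * triMat x i k * choleskyWeight n x)
      (triPos p) := by
  by_cases hj : j ≤ i
  · by_cases hk : k ≤ i
    · simpa only [triMat_apply, hj, hk, dif_pos] using integrableOn_mul_mul_choleskyWeight n _ _
    · simp [triMat_apply, hk]
  · simp [triMat_apply, hj]

lemma setIntegral_triMat_mul_triMat_mul_choleskyWeight {p n : ℕ} (hn : p ≤ n) (i j k : Fin p) :
    ∫ x in triPos p, triMat x i j * triMat x i k * choleskyWeight n x =
      (if j = k then if i = j then (n : ℝ) - (j : ℕ) else if j < i then 1 else 0 else 0) *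
        ∫ x in triPos p, choleskyWeight n x := by
  by_cases hj : j ≤ i
  · by_cases hk : k ≤ i
    · simp only [triMat_apply, hj, hk, dif_pos]
      refine (setIntegral_mul_mul_choleskyWeight hn ⟨(i, j), hj⟩ ⟨(i, k), hk⟩ rfl).trans ?_
      congr 1
      by_cases hjk : j = k
      · subst hjk
        by_cases hij : i = j
        · simp [hij]
        · simp [hij, lt_of_le_of_ne hj (Ne.symm hij)]
      · simp [hjk]
    · have : j ≠ k := fun h => hk (h ▸ hj)
      simp [triMat_apply, hk, this]
  · have h1 : i ≠ j := fun h => hj h.ge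
    have h2 : ¬ j < i := fun h => hj h.le
    simp [triMat_apply, hj, h1, h2]

lemma gram_triMat_mul_choleskyWeight {p : ℕ} (n : ℕ) (j k : Fin p) (x : TriCoords p) :
    ((triMat x)ᵀ * triMat x) j k * choleskyWeight n x =
      ∑ i, triMat x i j * triMat x i k * choleskyWeight n x := by
  simp only [Matrix.mul_apply, Matrix.transpose_apply, Finset.sum_mul]

lemma integrableOn_gram_triMat_mul_choleskyWeight {p : ℕ} (n : ℕ) (j k : Fin p) :
    IntegrableOn (fun x : TriCoords p => ((triMat x)ᵀ * triMat x) j k * choleskyWeight n x)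
      (triPos p) := by
  simp only [gram_triMat_mul_choleskyWeight]
  exact integrable_finsetSum _ fun i _ =>
    integrableOn_triMat_mul_triMat_mul_choleskyWeight n i j k

lemma setIntegral_gram_triMat_mul_choleskyWeight {p n : ℕ} (hn : p ≤ n) (j k : Fin p) :
    ∫ x in triPos p, ((triMat x)ᵀ * triMat x) j k * choleskyWeight n x =
      Matrix.diagonal (fun i : Fin p => (n : ℝ) + (p : ℝ) - 2 * ((i : ℕ) : ℝ) - 1) j k *
        ∫ x in triPos p, choleskyWeight n x := by
  simp only [gram_triMat_mul_choleskyWeight]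
  rw [integral_finsetSum _ fun i _ =>
    integrableOn_triMat_mul_triMat_mul_choleskyWeight n i j k]
  simp only [setIntegral_triMat_mul_triMat_mul_choleskyWeight hn]
  rw [← Finset.sum_mul]
  congr 1
  by_cases hjk : j = k
  · subst hjk
    simp only [if_true, Matrix.diagonal_apply_eq]
    have h (i : Fin p) : (if i = j then (n : ℝ) - (j : ℕ) else if j < i then 1 else 0) =
        (if i = j then (n : ℝ) - (j : ℕ) else 0) + if i ∈ Finset.Ioi j then 1 else 0 := by
      by_cases hij : i = j
      · simp [hij]
      · simp [hij]
    simp only [h, Finset.sum_add_distrib, Finset.sum_ite_eq', Finset.mem_univ, if_true]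
    rw [Finset.sum_ite_mem, Finset.univ_inter, Finset.sum_const, Fin.card_Ioi, Nat.sub_sub,
      nsmul_one, Nat.cast_sub (by have := j.2; omega)]
    push_cast
    ring
  · simp [hjk]

lemma triMat_det {p : ℕ} (x : TriCoords p) :
    (triMat x).det = ∏ i : Fin p, x ⟨(i, i), le_rfl⟩ := by
  rw [Matrix.det_of_isLowerTriangular]
  · simp [triMat_apply]
  · intro i j hij
    have : ¬ j ≤ i := not_le.mpr hij
    simp [triMat_apply, this]

lemma prod_lowIdx {p : ℕ} (f : Fin p → Fin p → ℝ) :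
    ∏ q : LowIdx p, f q.1.1 q.1.2 = ∏ i, ∏ j, if j ≤ i then f i j else 1 := by
  rw [← Finset.prod_subtype (Finset.univ.filter fun q : Fin p × Fin p => q.2 ≤ q.1) (by simp)
    (fun q => f q.1 q.2), Finset.prod_filter, Fintype.prod_prod_type]

lemma sum_sq_triMat {p : ℕ} (x : TriCoords p) :
    (triMat x * (triMat x)ᵀ).trace = ∑ q : LowIdx p, x q ^ 2 := by
  have h (q : LowIdx p) : x q = triMat x q.1.1 q.1.2 := by simp [triMat_apply, q.2]
  simp only [h]
  rw [← Finset.sum_subtype (Finset.univ.filter fun q : Fin p × Fin p => q.2 ≤ q.1) (by simp)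
    (fun q => triMat x q.1 q.2 ^ 2), Finset.sum_filter, Fintype.sum_prod_type]
  simp only [Matrix.trace, Matrix.diag_apply, Matrix.mul_apply, Matrix.transpose_apply]
  refine Finset.sum_congr rfl fun i _ => Finset.sum_congr rfl fun j _ => ?_
  by_cases hij : j ≤ i <;> simp [triMat_apply, hij, sq]

lemma choleskyWeight_eq {p n : ℕ} (hn : p ≤ n) {x : TriCoords p} (hx : x ∈ triPos p) :
    (triMat x).det ^ n * Real.exp (-(1 / 2) * (triMat x * (triMat x)ᵀ).trace) * gammaDensR x =
      choleskyWeight n x := by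
  have hdiag : ∏ q : LowIdx p, x q ^ coordExp n q =
      ∏ i : Fin p, x ⟨(i, i), le_rfl⟩ ^ (n - ((i : ℕ) + 1)) := by
    have h (q : LowIdx p) : x q ^ coordExp n q =
        (fun i j : Fin p => if i = j then triMat x i i ^ (n - ((i : ℕ) + 1)) else 1)
          q.1.1 q.1.2 := by
      obtain ⟨⟨i, j⟩, hij⟩ := q
      by_cases e : i = j
      · subst e; simp [coordExp, triMat_apply]
      · simp [coordExp, e]
    refine (Finset.prod_congr rfl fun q _ => h q).trans ((prod_lowIdx fun i j =>
      if i = j then triMat x i i ^ (n - ((i : ℕ) + 1)) else 1).trans ?_)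
    refine Finset.prod_congr rfl fun i _ => ?_
    rw [Finset.prod_eq_single i]
    · simp [triMat_apply]
    · intro j _ hj
      simp [Ne.symm hj]
    · simp
  rw [choleskyWeight, Finset.prod_mul_distrib, hdiag, ← Real.exp_sum, ← Finset.mul_sum,
    sum_sq_triMat, triMat_det, gammaDensR, ← Finset.prod_pow, mul_right_comm,
    ← Finset.prod_mul_distrib]
  congr 1
  refine Finset.prod_congr rfl fun i _ => ?_
  rw [← zpow_natCast, ← zpow_natCast, ← zpow_add₀ (hx i).ne',
    Nat.cast_sub (by have := i.2; omega)]
  congr 1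

/-- Right multiplication by a fixed matrix, in triangular coordinates. -/
noncomputable def triMulRight {p : ℕ} (T : Matrix (Fin p) (Fin p) ℝ) :
    TriCoords p →ₗ[ℝ] TriCoords p where
  toFun x q := (triMat x * T) q.1.1 q.1.2
  map_add' x y := by
    have : triMat (x + y) = triMat x + triMat y := by
      ext i j
      by_cases h : j ≤ i <;> simp [triMat_apply, h]
    ext q
    simp [this, Matrix.add_mul]
  map_smul' c x := by
    have : triMat (c • x) = c • triMat x := by
      ext i j
      by_cases h : j ≤ i <;> simp [triMat_apply, h]
    ext q
    simp [this]

lemma triMat_triMulRight {p : ℕ} {T : Matrix (Fin p) (Fin p) ℝ} (hT : memTplus T)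
    (x : TriCoords p) : triMat (triMulRight T x) = triMat x * T := by
  ext i j
  by_cases h : j ≤ i
  · simp [triMat_apply, h, triMulRight]
  · rw [triMat_apply, dif_neg h, Matrix.mul_apply, Finset.sum_eq_zero]
    intro k _
    by_cases hk : k ≤ i
    · rw [hT.1 k j (hk.trans_lt (not_le.mp h)), mul_zero]
    · simp [triMat_apply, hk]

lemma triMulRight_diag {p : ℕ} {T : Matrix (Fin p) (Fin p) ℝ} (hT : memTplus T)
    (x : TriCoords p) (i : Fin p) :
    triMulRight T x ⟨(i, i), le_rfl⟩ = x ⟨(i, i), le_rfl⟩ * T i i := by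
  change (triMat x * T) i i = _
  rw [Matrix.mul_apply, Finset.sum_eq_single i]
  · simp [triMat_apply]
  · intro k _ hk
    rcases lt_or_gt_of_ne hk with h | h
    · rw [hT.1 k i h, mul_zero]
    · simp [triMat_apply, not_le.mpr h]
  · simp

lemma triMat_injective (p : ℕ) : Function.Injective (triMat (p := p)) := by
  intro x y h
  ext ⟨⟨i, j⟩, hij⟩
  have := congrFun₂ h i j
  simp only at hij
  simpa [triMat_apply, hij] using this

lemma memTplus.isUnit_det {p : ℕ} {T : Matrix (Fin p) (Fin p) ℝ} (hT : memTplus T) :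
    IsUnit T.det := by
  rw [Matrix.det_of_isLowerTriangular _ fun i j hij => hT.1 i j hij, isUnit_iff_ne_zero]
  exact Finset.prod_ne_zero_iff.mpr fun i _ => (hT.2 i).ne'

lemma triMulRight_injective {p : ℕ} {T : Matrix (Fin p) (Fin p) ℝ} (hT : memTplus T) :
    Function.Injective (triMulRight T) := by
  intro x y h
  have h' : triMat x * T = triMat y * T := by
    rw [← triMat_triMulRight hT, ← triMat_triMulRight hT, h]
  apply triMat_injective
  rw [← Matrix.mul_nonsing_inv_cancel_right T (triMat x) hT.isUnit_det, h',
    Matrix.mul_nonsing_inv_cancel_right T _ hT.isUnit_det]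

lemma exists_setIntegral_comp_triMulRight {p : ℕ} {T : Matrix (Fin p) (Fin p) ℝ}
    (hT : memTplus T) :
    ∃ c : ℝ, 0 < c ∧ ∀ f : TriCoords p → ℝ,
      ∫ x in triPos p, f (triMulRight T x) = c * ∫ x in triPos p, f x := by
  have hinj := triMulRight_injective hT
  have hdet : LinearMap.det (triMulRight T) ≠ 0 := fun h =>
    (LinearMap.bot_lt_ker_of_det_eq_zero h).ne' (LinearMap.ker_eq_bot.mpr hinj)
  have hemb : MeasurableEmbedding (triMulRight T) :=
    (LinearMap.isClosedEmbedding_of_injective (LinearMap.ker_eq_bot.mpr hinj)).measurableEmbedding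
  have hpre : triMulRight T ⁻¹' triPos p = triPos p := by
    ext x
    simp only [triPos, Set.mem_preimage, Set.mem_ofPred_eq, triMulRight_diag hT,
      mul_pos_iff_of_pos_right (hT.2 _)]
  refine ⟨|(LinearMap.det (triMulRight T))⁻¹|, abs_pos.mpr (inv_ne_zero hdet), fun f => ?_⟩
  have h := hemb.setIntegral_map (μ := volume) f (triPos p)
  rw [hpre, Measure.map_linearMap_addHaar_eq_smul_addHaar _ hdet, Measure.restrict_smul,
    integral_smul_measure, ENNReal.toReal_ofReal (abs_nonneg _), smul_eq_mul] at h
  exact h.symm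

lemma wishartC_pos {p n : ℕ} (hn : p ≤ n) : 0 < wishartC p n := by
  unfold wishartC
  have h : 0 < ∏ i : Fin p, Real.Gamma (((n : ℝ) - (i : ℕ)) / 2) := by
    refine Finset.prod_pos fun i _ => Real.Gamma_pos_of_pos (half_pos (sub_pos.mpr ?_))
    exact_mod_cast i.2.trans_le hn
  have := Real.pi_pos
  positivity

lemma gammaDensR_triMulRight {p : ℕ} {T : Matrix (Fin p) (Fin p) ℝ} (hT : memTplus T)
    (x : TriCoords p) :
    gammaDensR x = (∏ i : Fin p, T i i ^ ((i : ℕ) + 1)) * gammaDensR (triMulRight T x) := by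
  simp only [gammaDensR, triMulRight_diag hT, ← Finset.prod_mul_distrib]
  refine Finset.prod_congr rfl fun i _ => ?_
  have := (hT.2 i).ne'
  rw [mul_zpow, ← zpow_natCast, mul_left_comm, ← zpow_add₀ this]
  simp

lemma wishartDens_mul_gammaDensR {p n : ℕ} (hn : p ≤ n) {T : Matrix (Fin p) (Fin p) ℝ}
    (hT : memTplus T) {x : TriCoords p} (hx : x ∈ triPos p) :
    wishartDens p n (triMat x) T * gammaDensR x =
      (∏ i : Fin p, T i i ^ ((i : ℕ) + 1)) / wishartC p n *
        choleskyWeight n (triMulRight T x) := by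
  have hx' : triMulRight T x ∈ triPos p := fun i => by
    rw [triMulRight_diag hT]
    exact mul_pos (hx i) (hT.2 i)
  rw [← choleskyWeight_eq hn hx', gammaDensR_triMulRight hT, wishartDens, triMat_triMulRight hT]
  ring

/-- (James–Stein best equivariant estimator) The generalized Bayes estimator under
Stein loss with respect to the prior `γ(dΘ)` equals the James–Stein estimator
`T diag(d₁, …, d_p) Tᵀ` with `d_i = 1/(n+p-2i+1)`. -/
theorem james_stein_generalized_bayes
    (p n : ℕ) (hp : 1 ≤ p) (hn : p ≤ n)
    (T : Matrix (Fin p) (Fin p) ℝ) (hT : memTplus T) :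
    (∫ y in triPos p, wishartDens p n (triMat y) T * gammaDensR y) •
        (Matrix.of fun i j : Fin p =>
          ∫ y in triPos p,
            ((triMat y)ᵀ * triMat y) i j *
              (wishartDens p n (triMat y) T * gammaDensR y))⁻¹ =
      T * Matrix.diagonal (fun i : Fin p =>
        ((n : ℝ) + (p : ℝ) - 2 * ((i : ℕ) : ℝ) - 1)⁻¹) * Tᵀ := by
  obtain ⟨c, hc, hcov⟩ := exists_setIntegral_comp_triMulRight hT
  set k : ℝ := (∏ i : Fin p, T i i ^ ((i : ℕ) + 1)) / wishartC p n
  have hkpos : 0 < k := div_pos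
    (Finset.prod_pos fun i _ => pow_pos (hT.2 i) _) (wishartC_pos hn)
  set Z : ℝ := ∫ x in triPos p, choleskyWeight n x
  have hZpos : 0 < Z := setIntegral_choleskyWeight_pos p n
  set E : Fin p → ℝ := fun i => (n : ℝ) + (p : ℝ) - 2 * ((i : ℕ) : ℝ) - 1 with hE
  have hEpos (i : Fin p) : E i ≠ 0 := by
    have h1 : ((i : ℕ) : ℝ) + 1 ≤ p := by exact_mod_cast i.2
    have h2 : (p : ℝ) ≤ n := by exact_mod_cast hn
    simp only [hE]
    linarith
  have hscalar : ∫ y in triPos p, wishartDens p n (triMat y) T * gammaDensR y = k * c * Z := by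
    rw [setIntegral_congr_fun (measurableSet_triPos p)
      fun y hy => wishartDens_mul_gammaDensR hn hT hy, integral_const_mul, hcov, mul_assoc]
  have hmatrix : (Matrix.of fun i j : Fin p => ∫ y in triPos p,
      ((triMat y)ᵀ * triMat y) i j * (wishartDens p n (triMat y) T * gammaDensR y)) =
      (k * c * Z) • ((T⁻¹)ᵀ * Matrix.diagonal E * T⁻¹) := by
    ext i j
    have hentry (y : TriCoords p) (hy : y ∈ triPos p) :
        ((triMat y)ᵀ * triMat y) i j * (wishartDens p n (triMat y) T * gammaDensR y) =
        k * (fun x => ∑ b, ∑ a, T⁻¹ a i * T⁻¹ b j *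
          (((triMat x)ᵀ * triMat x) a b * choleskyWeight n x)) (triMulRight T y) := by
      have hy' : triMat y = triMat (triMulRight T y) * T⁻¹ := by
        rw [triMat_triMulRight hT, Matrix.mul_nonsing_inv_cancel_right _ _ hT.isUnit_det]
      have hgram : (triMat y)ᵀ * triMat y = (T⁻¹)ᵀ *
          ((triMat (triMulRight T y))ᵀ * triMat (triMulRight T y)) * T⁻¹ := by
        rw [hy', Matrix.transpose_mul]
        simp only [Matrix.mul_assoc, ← hy']
      rw [wishartDens_mul_gammaDensR hn hT hy, hgram, Matrix.mul_apply]
      simp only [Matrix.mul_apply (M := (T⁻¹)ᵀ), Matrix.transpose_apply (M := T⁻¹),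
        Finset.sum_mul, Finset.mul_sum]
      refine Finset.sum_congr rfl fun b _ => Finset.sum_congr rfl fun a _ => ?_
      ring
    have hintegrable (a b : Fin p) := (integrableOn_gram_triMat_mul_choleskyWeight n a b).const_mul
      (T⁻¹ a i * T⁻¹ b j)
    rw [Matrix.of_apply, setIntegral_congr_fun (measurableSet_triPos p) hentry,
      integral_const_mul, hcov (fun x => ∑ b, ∑ a, T⁻¹ a i * T⁻¹ b j *
        (((triMat x)ᵀ * triMat x) a b * choleskyWeight n x)),
      integral_finsetSum _ fun b _ => integrable_finsetSum _ fun a _ => hintegrable a b]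
    simp only [integral_finsetSum _ fun a _ => hintegrable a _, integral_const_mul,
      setIntegral_gram_triMat_mul_choleskyWeight hn]
    rw [Matrix.smul_apply, Matrix.mul_apply, smul_eq_mul]
    simp only [Matrix.mul_apply (M := (T⁻¹)ᵀ), Matrix.transpose_apply, Finset.sum_mul,
      Finset.mul_sum]
    refine Finset.sum_congr rfl fun b _ => Finset.sum_congr rfl fun a _ => ?_
    ring
  rw [hscalar, hmatrix]
  have hW : k * c * Z ≠ 0 := by positivity
  have hinv : ((k * c * Z) • ((T⁻¹)ᵀ * Matrix.diagonal E * T⁻¹))⁻¹ =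
      (k * c * Z)⁻¹ • (T * Matrix.diagonal (fun i => (E i)⁻¹) * Tᵀ) := by
    apply Matrix.inv_eq_right_inv
    have hD : Matrix.diagonal E * Matrix.diagonal (fun i => (E i)⁻¹) = 1 := by
      rw [Matrix.diagonal_mul_diagonal, ← Matrix.diagonal_one]
      congr 1
      ext i
      exact mul_inv_cancel₀ (hEpos i)
    rw [Matrix.smul_mul, Matrix.mul_smul, smul_smul, mul_inv_cancel₀ hW, one_smul]
    calc (T⁻¹)ᵀ * Matrix.diagonal E * T⁻¹ * (T * Matrix.diagonal (fun i => (E i)⁻¹) * Tᵀ)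
        = (T⁻¹)ᵀ * (Matrix.diagonal E * ((T⁻¹ * T) * Matrix.diagonal (fun i => (E i)⁻¹))) *
            Tᵀ := by simp only [Matrix.mul_assoc]
      _ = 1 := by
        rw [Matrix.nonsing_inv_mul _ hT.isUnit_det, Matrix.one_mul, hD, Matrix.mul_one,
          ← Matrix.transpose_mul, Matrix.mul_nonsing_inv _ hT.isUnit_det, Matrix.transpose_one]
  rw [hinv, smul_smul, mul_inv_cancel₀ hW, one_smul]
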